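/- arXiv:2501.00266 — 2 statements merged into one kernel-verified Lean document; each statement's English description precedes it below -/
import Mathlib

section
/- Let F be a skew product such that ℙ×Leb is ergodic with respect to F, and suppose the following asymptotic occupational time condition (OT2) holds: there exist constants γ₀ < γ₁ in (0,1) and Borel sets B₀, B₁ ⊆ [0,1] with Leb(B₀) > 0 and Leb(B₁) > 0 such that for i = 0,1 and every x ∈ B_i, limsup_{n→∞} (1/n)∑_{j=0}^{n-1} 1_{I_i(γ_i)}(f_ω^j(x)) = 1 for ℙ-almost every ω. Then for (ℙ×Leb)-almost every (ω,x) ∈ Ω×[0,1]: liminf_{n→∞} (1/n)∑_{j=0}^{n-1} f_ω^j(x) ≤ γ₀ and limsup_{n→∞} (1/n)∑_{j=0}^{n-1} f_ω^j(x) ≥ γ₁. -/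
open MeasureTheory Filter Set

noncomputable section

/-- Fiber compositions of a skew product over the base map `σ`:
`fib σ f ω n = f_{σ^{n-1} ω} ∘ ⋯ ∘ f_ω`. -/
def fib {Ω : Type*} (σ : Ω → Ω) (f : Ω → ℝ → ℝ) (ω : Ω) : ℕ → ℝ → ℝ
  | 0 => id
  | n + 1 => f (σ^[n] ω) ∘ fib σ f ω n

/-- The reference measure `ℙ × Leb` on `Ω × [0,1]`. -/
def refMeasure {Ω : Type*} [MeasurableSpace Ω] (ℙ : Measure Ω) : Measure (Ω × ℝ) :=
  ℙ.prod (volume.restrict (Set.Icc (0:ℝ) 1))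

/-- `ℙ × Leb` is ergodic with respect to the skew product `F(ω,x) = (σ ω, f ω x)`:
every measurable subset `A` of `Ω × [0,1]` with `F(A) ⊆ A` has measure `0` or `1`. -/
def ErgodicRef {Ω : Type*} [MeasurableSpace Ω] (ℙ : Measure Ω) (σ : Ω → Ω)
    (f : Ω → ℝ → ℝ) : Prop :=
  ∀ A : Set (Ω × ℝ), MeasurableSet A → A ⊆ Set.univ ×ˢ Set.Icc (0:ℝ) 1 →
    (fun q : Ω × ℝ => (σ q.1, f q.1 q.2)) '' A ⊆ A →
    refMeasure ℙ A = 0 ∨ refMeasure ℙ A = 1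


theorem aux_ae {Ω : Type*} [MeasurableSpace Ω] (ℙ : Measure Ω) [IsProbabilityMeasure ℙ]
    (σ : Ω → Ω) (f : Ω → ℝ → ℝ)
    (hfI : ∀ ω, MapsTo (f ω) (Icc (0:ℝ) 1) (Icc (0:ℝ) 1))
    (herg : ErgodicRef ℙ σ f) (A : Set (Ω × ℝ)) (hA : MeasurableSet A)
    (hinv : ∀ q ∈ A, q.2 ∈ Icc (0:ℝ) 1 → (σ q.1, f q.1 q.2) ∈ A)
    (B : Set ℝ) (hB : B ⊆ Icc (0:ℝ) 1) (hBpos : 0 < volume B)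
    (hAB : ∀ x ∈ B, ∀ᵐ ω ∂ℙ, (ω, x) ∈ A) :
    ∀ᵐ q ∂(refMeasure ℙ), q ∈ A := by
  have hSm : MeasurableSet (A ∩ (univ ×ˢ Icc (0:ℝ) 1)) :=
    hA.inter (MeasurableSet.univ.prod measurableSet_Icc)
  have : IsProbabilityMeasure (volume.restrict (Icc (0:ℝ) 1)) := ⟨by simp⟩
  have : IsProbabilityMeasure (refMeasure ℙ) := by unfold refMeasure; infer_instance
  rcases herg _ hSm inter_subset_right (by
    rintro _ ⟨q, ⟨hq, -, hq2⟩, rfl⟩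
    exact ⟨hinv q hq hq2, trivial, hfI _ hq2⟩) with h | h
  · exfalso
    unfold refMeasure at h
    rw [Measure.prod_apply_symm hSm,
      lintegral_eq_zero_iff (measurable_measure_prodMk_right hSm)] at h
    rw [Filter.EventuallyEq, ae_restrict_iff' measurableSet_Icc] at h
    have h2 : ∀ᵐ x : ℝ, x ∉ B := by
      filter_upwards [h] with x hx hxB
      have h3 := hx (hB hxB)
      have h4 : ∀ᵐ ω ∂ℙ, ω ∈ (fun ω => (ω, x)) ⁻¹' (A ∩ (univ ×ˢ Icc (0:ℝ) 1)) := by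
        filter_upwards [hAB x hxB] with ω hω
        exact ⟨hω, trivial, hB hxB⟩
      have h5 := prob_compl_eq_zero_iff (μ := ℙ) (hSm.preimage (measurable_prodMk_right (y := x)))
      have h6 := h5.1 h4
      simp only [Pi.zero_apply] at h3
      rw [h3] at h6
      exact zero_ne_one h6
    have h7 : volume B = 0 := by
      rw [measure_eq_zero_iff_ae_notMem]; exact h2
    exact hBpos.ne' h7
  · have := (prob_compl_eq_zero_iff hSm).2 h
    have h2 : ∀ᵐ q ∂(refMeasure ℙ), q ∈ A ∩ (univ ×ˢ Icc (0:ℝ) 1) := this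
    filter_upwards [h2] with q hq using hq.1

theorem aux_fib_mem {Ω : Type*} (σ : Ω → Ω) (f : Ω → ℝ → ℝ)
    (hfI : ∀ ω, MapsTo (f ω) (Icc (0:ℝ) 1) (Icc (0:ℝ) 1)) (ω : Ω) (x : ℝ)
    (hx : x ∈ Icc (0:ℝ) 1) (n : ℕ) : fib σ f ω n x ∈ Icc (0:ℝ) 1 := by
  induction n with
  | zero => exact hx
  | succ k ih => exact hfI _ ih

theorem aux_fib_shift {Ω : Type*} (σ : Ω → Ω) (f : Ω → ℝ → ℝ) (ω : Ω) (x : ℝ) (n : ℕ) :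
    fib σ f (σ ω) n (f ω x) = fib σ f ω (n + 1) x := by
  induction n with
  | zero => rfl
  | succ k ih =>
    change f (σ^[k] (σ ω)) (fib σ f (σ ω) k (f ω x)) = f (σ^[k+1] ω) (fib σ f ω (k+1) x)
    rw [ih]; rfl

theorem aux_fib_meas {Ω : Type*} [MeasurableSpace Ω] (σ : Ω → Ω) (hσ : Measurable σ)
    (f : Ω → ℝ → ℝ) (hfm : Measurable (Function.uncurry f)) (n : ℕ) :
    Measurable (fun q : Ω × ℝ => fib σ f q.1 n q.2) := by
  induction n with
  | zero => exact measurable_snd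
  | succ k ih =>
    exact hfm.comp (((hσ.iterate k).comp measurable_fst).prodMk ih)

theorem aux_avg_mem (u : ℕ → ℝ) (hu : ∀ n, u n ∈ Icc (0:ℝ) 1) (n : ℕ) :
    (n:ℝ)⁻¹ * ∑ j ∈ Finset.range n, u j ∈ Icc (0:ℝ) 1 := by
  have h1 : 0 ≤ ∑ j ∈ Finset.range n, u j := Finset.sum_nonneg fun j _ => (hu j).1
  have h2 : ∑ j ∈ Finset.range n, u j ≤ n := by
    simpa using Finset.sum_le_sum (s := Finset.range n) fun j _ => (hu j).2
  refine ⟨by positivity, ?_⟩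
  calc (n:ℝ)⁻¹ * ∑ j ∈ Finset.range n, u j ≤ (n:ℝ)⁻¹ * n := by gcongr
    _ ≤ 1 := inv_mul_le_one

theorem aux_shift (u : ℕ → ℝ) (hu : ∀ n, u n ∈ Icc (0:ℝ) 1) :
    Tendsto (fun n : ℕ => (n:ℝ)⁻¹ * ∑ j ∈ Finset.range n, u (j + 1) -
      (n:ℝ)⁻¹ * ∑ j ∈ Finset.range n, u j) atTop (nhds 0) := by
  have h : ∀ n : ℕ, (n:ℝ)⁻¹ * ∑ j ∈ Finset.range n, u (j + 1) -
      (n:ℝ)⁻¹ * ∑ j ∈ Finset.range n, u j = (n:ℝ)⁻¹ * (u n - u 0) := by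
    intro n
    rw [← mul_sub, ← Finset.sum_sub_distrib, Finset.sum_range_sub]
  simp_rw [h]
  refine squeeze_zero_norm (a := fun n : ℕ => (n:ℝ)⁻¹) (fun n => ?_) tendsto_inv_atTop_nhds_zero_nat
  rw [norm_mul, Real.norm_of_nonneg (by positivity : (0:ℝ) ≤ (n:ℝ)⁻¹)]
  have : ‖u n - u 0‖ ≤ 1 := by
    rw [Real.norm_eq_abs, abs_le]
    constructor <;> linarith [(hu n).1, (hu n).2, (hu 0).1, (hu 0).2]
  exact mul_le_of_le_one_right (by positivity) this

theorem aux_bdd_ge (a : ℕ → ℝ) (ha : ∀ n, a n ∈ Icc (0:ℝ) 1) :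
    IsBoundedUnder (· ≥ ·) atTop a := isBoundedUnder_of ⟨0, fun n => (ha n).1⟩

theorem aux_bdd_le (a : ℕ → ℝ) (ha : ∀ n, a n ∈ Icc (0:ℝ) 1) :
    IsBoundedUnder (· ≤ ·) atTop a := isBoundedUnder_of ⟨1, fun n => (ha n).2⟩

theorem aux_liminf_iff (a : ℕ → ℝ) (ha : ∀ n, a n ∈ Icc (0:ℝ) 1) (c : ℝ) :
    liminf a atTop ≤ c ↔ ∀ ε > 0, ∃ᶠ n in atTop, a n < c + ε := by
  constructor
  · intro h ε hε
    exact frequently_lt_of_liminf_lt (aux_bdd_le a ha).isCoboundedUnder_ge (by linarith)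
  · intro h
    refine le_of_forall_pos_le_add fun ε hε => ?_
    exact liminf_le_of_frequently_le ((h ε hε).mono fun n hn => hn.le) (aux_bdd_ge a ha)

theorem aux_limsup_iff (a : ℕ → ℝ) (ha : ∀ n, a n ∈ Icc (0:ℝ) 1) (c : ℝ) :
    c ≤ limsup a atTop ↔ ∀ ε > 0, ∃ᶠ n in atTop, c - ε < a n := by
  constructor
  · intro h ε hε
    exact frequently_lt_of_lt_limsup (aux_bdd_ge a ha).isCoboundedUnder_le (by linarith)
  · intro h
    refine le_of_forall_pos_le_add fun ε hε => ?_
    have := le_limsup_of_frequently_le ((h ε hε).mono fun n hn => hn.le) (aux_bdd_le a ha)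
    linarith

theorem aux_liminf_mono (a b : ℕ → ℝ) (ha : ∀ n, a n ∈ Icc (0:ℝ) 1)
    (hb : ∀ n, b n ∈ Icc (0:ℝ) 1) (hab : Tendsto (fun n => b n - a n) atTop (nhds 0)) (c : ℝ)
    (h : liminf a atTop ≤ c) : liminf b atTop ≤ c := by
  rw [aux_liminf_iff _ ha] at h
  rw [aux_liminf_iff _ hb]
  intro ε hε
  have h1 := hab.eventually_lt_const (half_pos hε)
  refine ((h _ (half_pos hε)).and_eventually h1).mono ?_
  rintro n ⟨h2, h3⟩
  linarith

theorem aux_limsup_mono (a b : ℕ → ℝ) (ha : ∀ n, a n ∈ Icc (0:ℝ) 1)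
    (hb : ∀ n, b n ∈ Icc (0:ℝ) 1) (hab : Tendsto (fun n => b n - a n) atTop (nhds 0)) (c : ℝ)
    (h : c ≤ limsup a atTop) : c ≤ limsup b atTop := by
  rw [aux_limsup_iff _ ha] at h
  rw [aux_limsup_iff _ hb]
  intro ε hε
  have h1 := hab.eventually_const_lt (neg_lt_zero.2 (half_pos hε))
  refine ((h _ (half_pos hε)).and_eventually h1).mono ?_
  rintro n ⟨h2, h3⟩
  linarith

theorem aux_ind_mem (s : Set ℝ) (y : ℝ) : s.indicator (1 : ℝ → ℝ) y ∈ Icc (0:ℝ) 1 := by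
  by_cases h : y ∈ s <;> simp [h]

theorem aux_point0 (u : ℕ → ℝ) (hu : ∀ n, u n ∈ Icc (0:ℝ) 1) (c : ℝ) (hc : c ∈ Ioo (0:ℝ) 1)
    (h : limsup (fun n : ℕ => (n:ℝ)⁻¹ * ∑ j ∈ Finset.range n,
      (Icc (0:ℝ) c).indicator (1 : ℝ → ℝ) (u j)) atTop = 1) :
    liminf (fun n : ℕ => (n:ℝ)⁻¹ * ∑ j ∈ Finset.range n, u j) atTop ≤ c := by
  have h1 := (aux_limsup_iff _ (aux_avg_mem _ fun n => aux_ind_mem _ _) 1).1 h.ge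
  rw [aux_liminf_iff _ (aux_avg_mem u hu)]
  intro ε hε
  refine ((h1 ε hε).and_eventually (eventually_gt_atTop 0)).mono ?_
  rintro n ⟨h2, h3⟩
  have hn : (0:ℝ) < n := by exact_mod_cast h3
  have key : ∑ j ∈ Finset.range n, u j ≤ ∑ j ∈ Finset.range n,
      (1 - (1 - c) * (Icc (0:ℝ) c).indicator (1 : ℝ → ℝ) (u j)) := by
    refine Finset.sum_le_sum fun j _ => ?_
    by_cases hj : u j ∈ Icc 0 c
    · simp only [indicator_of_mem hj, Pi.one_apply]; linarith [hj.2]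
    · simp only [indicator_of_notMem hj]; linarith [(hu j).2]
  rw [Finset.sum_sub_distrib, ← Finset.mul_sum] at key
  simp only [Finset.sum_const, Finset.card_range, nsmul_eq_mul, mul_one] at key
  set S := ∑ j ∈ Finset.range n, (Icc (0:ℝ) c).indicator (1 : ℝ → ℝ) (u j)
  have k2 : (n:ℝ)⁻¹ * ∑ j ∈ Finset.range n, u j ≤ (n:ℝ)⁻¹ * (n - (1 - c) * S) := by gcongr
  have k3 : (n:ℝ)⁻¹ * (n - (1 - c) * S) = 1 - (1 - c) * ((n:ℝ)⁻¹ * S) := by field_simp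
  nlinarith [hc.1, hc.2]

theorem aux_point1 (u : ℕ → ℝ) (hu : ∀ n, u n ∈ Icc (0:ℝ) 1) (c : ℝ) (hc : c ∈ Ioo (0:ℝ) 1)
    (h : limsup (fun n : ℕ => (n:ℝ)⁻¹ * ∑ j ∈ Finset.range n,
      (Icc c (1:ℝ)).indicator (1 : ℝ → ℝ) (u j)) atTop = 1) :
    c ≤ limsup (fun n : ℕ => (n:ℝ)⁻¹ * ∑ j ∈ Finset.range n, u j) atTop := by
  have h1 := (aux_limsup_iff _ (aux_avg_mem _ fun n => aux_ind_mem _ _) 1).1 h.ge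
  rw [aux_limsup_iff _ (aux_avg_mem u hu)]
  intro ε hε
  refine (h1 ε hε).mono ?_
  intro n h2
  have key : ∑ j ∈ Finset.range n, c * (Icc c (1:ℝ)).indicator (1 : ℝ → ℝ) (u j) ≤
      ∑ j ∈ Finset.range n, u j := by
    refine Finset.sum_le_sum fun j _ => ?_
    by_cases hj : u j ∈ Icc c 1
    · simp only [indicator_of_mem hj, Pi.one_apply]; linarith [hj.1]
    · simp only [indicator_of_notMem hj]; linarith [(hu j).1]
  rw [← Finset.mul_sum] at key
  set S := ∑ j ∈ Finset.range n, (Icc c (1:ℝ)).indicator (1 : ℝ → ℝ) (u j)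
  have k2 : (n:ℝ)⁻¹ * (c * S) ≤ (n:ℝ)⁻¹ * ∑ j ∈ Finset.range n, u j := by gcongr
  have k3 : (n:ℝ)⁻¹ * (c * S) = c * ((n:ℝ)⁻¹ * S) := by ring
  nlinarith [hc.1, hc.2]

theorem statement3 {Ω : Type*} [MeasurableSpace Ω] [StandardBorelSpace Ω]
    (ℙ : Measure Ω) [IsProbabilityMeasure ℙ] (σ : Ω → Ω) (hσ : Ergodic σ ℙ)
    (f : Ω → ℝ → ℝ) (hfm : Measurable (Function.uncurry f))
    (hfI : ∀ ω, MapsTo (f ω) (Icc (0:ℝ) 1) (Icc (0:ℝ) 1))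
    (herg : ErgodicRef ℙ σ f)
    (γ₀ γ₁ : ℝ) (hγ₀ : γ₀ ∈ Ioo (0:ℝ) 1) (hγ₁ : γ₁ ∈ Ioo (0:ℝ) 1) (hγ : γ₀ < γ₁)
    (B₀ B₁ : Set ℝ) (hB₀m : MeasurableSet B₀) (hB₁m : MeasurableSet B₁)
    (hB₀ : B₀ ⊆ Icc (0:ℝ) 1) (hB₁ : B₁ ⊆ Icc (0:ℝ) 1)
    (hB₀pos : 0 < volume B₀) (hB₁pos : 0 < volume B₁)
    (hOT0 : ∀ x ∈ B₀, ∀ᵐ ω ∂ℙ, Filter.limsup (fun n : ℕ => (n:ℝ)⁻¹ *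
      ∑ j ∈ Finset.range n, (Icc (0:ℝ) γ₀).indicator 1 (fib σ f ω j x)) atTop = 1)
    (hOT1 : ∀ x ∈ B₁, ∀ᵐ ω ∂ℙ, Filter.limsup (fun n : ℕ => (n:ℝ)⁻¹ *
      ∑ j ∈ Finset.range n, (Icc γ₁ (1:ℝ)).indicator 1 (fib σ f ω j x)) atTop = 1) :
    ∀ᵐ q ∂(refMeasure ℙ),
      Filter.liminf (fun n : ℕ => (n:ℝ)⁻¹ * ∑ j ∈ Finset.range n, fib σ f q.1 j q.2)
        atTop ≤ γ₀ ∧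
      γ₁ ≤ Filter.limsup (fun n : ℕ => (n:ℝ)⁻¹ * ∑ j ∈ Finset.range n, fib σ f q.1 j q.2)
        atTop := by
  have hm : ∀ n : ℕ, Measurable (fun q : Ω × ℝ =>
      (n:ℝ)⁻¹ * ∑ j ∈ Finset.range n, fib σ f q.1 j q.2) := fun n =>
    (Finset.measurable_fun_sum _ fun j _ => aux_fib_meas σ hσ.measurable f hfm j).const_mul _
  have e0 := aux_ae ℙ σ f hfI herg {q | Filter.liminf (fun n : ℕ => (n:ℝ)⁻¹ *
      ∑ j ∈ Finset.range n, fib σ f q.1 j q.2) atTop ≤ γ₀}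
    (measurableSet_le (Measurable.liminf hm) measurable_const)
    (by
      rintro ⟨ω, x⟩ hq hx
      simp only [mem_ofPred_eq, aux_fib_shift] at hq ⊢
      have hu := aux_fib_mem σ f hfI ω x hx
      exact aux_liminf_mono _ _ (aux_avg_mem (fun j => fib σ f ω j x) hu)
        (aux_avg_mem (fun j => fib σ f ω (j + 1) x) fun n => hu (n + 1))
        (aux_shift (fun j => fib σ f ω j x) hu) _ hq)
    B₀ hB₀ hB₀pos (by
      intro x hx
      filter_upwards [hOT0 x hx] with ω hω
      exact aux_point0 (fun j => fib σ f ω j x) (aux_fib_mem σ f hfI ω x (hB₀ hx)) _ hγ₀ hω)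
  have e1 := aux_ae ℙ σ f hfI herg {q | γ₁ ≤ Filter.limsup (fun n : ℕ => (n:ℝ)⁻¹ *
      ∑ j ∈ Finset.range n, fib σ f q.1 j q.2) atTop}
    (measurableSet_le measurable_const (Measurable.limsup hm))
    (by
      rintro ⟨ω, x⟩ hq hx
      simp only [mem_ofPred_eq, aux_fib_shift] at hq ⊢
      have hu := aux_fib_mem σ f hfI ω x hx
      exact aux_limsup_mono _ _ (aux_avg_mem (fun j => fib σ f ω j x) hu)
        (aux_avg_mem (fun j => fib σ f ω (j + 1) x) fun n => hu (n + 1))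
        (aux_shift (fun j => fib σ f ω j x) hu) _ hq)
    B₁ hB₁ hB₁pos (by
      intro x hx
      filter_upwards [hOT1 x hx] with ω hω
      exact aux_point1 (fun j => fib σ f ω j x) (aux_fib_mem σ f hfI ω x (hB₁ hx)) _ hγ₁ hω)
  filter_upwards [e0, e1] with q h0 h1 using ⟨h0, h1⟩
end
end

section
/- Let F be a skew product such that ℙ×Leb is ergodic with respect to F, and suppose F satisfies the fiberwise fluctuation law: there exist constants γ₀, γ₁ ∈ (0,1) and Borel sets B₀, B₁ ⊆ [0,1] with Leb(B₀) > 0 and Leb(B₁) > 0 such that for i = 0,1, every α ∈ (0,1) and every x ∈ B_i, liminf_{n→∞} ℙ( { ω : (1/n)∑_{j=0}^{n-1} 1_{I_i(γ_i)}(f_ω^j(x)) ≤ α } ) < 1. Then for i = 0,1: limsup_{n→∞} (1/n)∑_{j=0}^{n-1} 1_{I_i(γ_i)}(f_ω^j(x)) = 1 for (ℙ×Leb)-almost every (ω,x) ∈ Ω×[0,1]. -/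
open MeasureTheory Filter Set

noncomputable section

theorem fib_shift {Ω : Type*} (σ : Ω → Ω) (f : Ω → ℝ → ℝ) (ω : Ω) (n : ℕ) (x : ℝ) :
    fib σ f (σ ω) n (f ω x) = fib σ f ω (n + 1) x := by
  induction n with
  | zero => rfl
  | succ k ih =>
    change f (σ^[k] (σ ω)) (fib σ f (σ ω) k (f ω x)) = f (σ^[k + 1] ω) (fib σ f ω (k + 1) x)
    rw [ih]; rfl

theorem fib_measurable {Ω : Type*} [MeasurableSpace Ω] {σ : Ω → Ω} (hσ : Measurable σ)
    {f : Ω → ℝ → ℝ} (hfm : Measurable (Function.uncurry f)) (n : ℕ) :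
    Measurable (fun q : Ω × ℝ => fib σ f q.1 n q.2) := by
  induction n with
  | zero => exact measurable_snd
  | succ k ih =>
    exact hfm.comp (((hσ.iterate k).comp measurable_fst).prodMk ih)

/-- Birkhoff sums of the indicator of `I`. -/
def bsum {Ω : Type*} (σ : Ω → Ω) (f : Ω → ℝ → ℝ) (I : Set ℝ) (n : ℕ) (q : Ω × ℝ) : ℝ :=
  ∑ j ∈ Finset.range n, I.indicator 1 (fib σ f q.1 j q.2)

theorem bsum_measurable {Ω : Type*} [MeasurableSpace Ω] {σ : Ω → Ω} (hσ : Measurable σ)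
    {f : Ω → ℝ → ℝ} (hfm : Measurable (Function.uncurry f)) {I : Set ℝ} (hI : MeasurableSet I)
    (n : ℕ) : Measurable (bsum σ f I n) := by
  unfold bsum
  refine Finset.measurable_sum _ fun j _ => ?_
  exact (measurable_one.indicator hI).comp (fib_measurable hσ hfm j)

theorem ind_le {I : Set ℝ} (x : ℝ) : I.indicator (1 : ℝ → ℝ) x ≤ 1 :=
  Set.indicator_le_self' (f := (1 : ℝ → ℝ)) (fun _ _ => zero_le_one) x

theorem bsum_le {Ω : Type*} (σ : Ω → Ω) (f : Ω → ℝ → ℝ) (I : Set ℝ) (n : ℕ) (q : Ω × ℝ) :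
    bsum σ f I n q ≤ n := by
  unfold bsum
  refine (Finset.sum_le_sum fun j _ => ind_le _).trans ?_
  simp

theorem bsum_nonneg {Ω : Type*} (σ : Ω → Ω) (f : Ω → ℝ → ℝ) (I : Set ℝ) (n : ℕ) (q : Ω × ℝ) :
    0 ≤ bsum σ f I n q :=
  Finset.sum_nonneg fun _ _ => Set.indicator_nonneg (fun _ _ => zero_le_one) _

theorem bsum_shift {Ω : Type*} (σ : Ω → Ω) (f : Ω → ℝ → ℝ) (I : Set ℝ) (n : ℕ) (q : Ω × ℝ) :
    bsum σ f I (n + 1) q ≤ bsum σ f I n (σ q.1, f q.1 q.2) + 1 := by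
  unfold bsum
  rw [Finset.sum_range_succ']
  simp only [fib_shift]
  gcongr
  exact ind_le _

/-- The forward invariant set. -/
def goodSet {Ω : Type*} (σ : Ω → Ω) (f : Ω → ℝ → ℝ) (I : Set ℝ) (α : ℝ) : Set (Ω × ℝ) :=
  {q | q.2 ∈ Icc (0:ℝ) 1 ∧ ∃ C : ℕ, ∃ᶠ n : ℕ in atTop, α * n - C < bsum σ f I n q}

theorem goodSet_measurable {Ω : Type*} [MeasurableSpace Ω] {σ : Ω → Ω} (hσ : Measurable σ)
    {f : Ω → ℝ → ℝ} (hfm : Measurable (Function.uncurry f)) {I : Set ℝ} (hI : MeasurableSet I)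
    (α : ℝ) : MeasurableSet (goodSet σ f I α) := by
  have : goodSet σ f I α = (Prod.snd ⁻¹' Icc (0:ℝ) 1) ∩
      ⋃ C : ℕ, ⋂ N : ℕ, ⋃ n : ℕ, ⋃ (_ : N ≤ n), {q | α * n - C < bsum σ f I n q} := by
    ext q
    simp [goodSet, frequently_atTop]
  rw [this]
  refine (measurable_snd measurableSet_Icc).inter ?_
  refine MeasurableSet.iUnion fun C => MeasurableSet.iInter fun N => MeasurableSet.iUnion fun n =>
    MeasurableSet.iUnion fun _ => ?_
  exact measurableSet_lt measurable_const (bsum_measurable hσ hfm hI n)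

theorem goodSet_inv {Ω : Type*} {σ : Ω → Ω}
    {f : Ω → ℝ → ℝ} (hfI : ∀ ω, MapsTo (f ω) (Icc (0:ℝ) 1) (Icc (0:ℝ) 1)) {I : Set ℝ}
    {α : ℝ} (hα : 0 < α) :
    (fun q : Ω × ℝ => (σ q.1, f q.1 q.2)) '' goodSet σ f I α ⊆ goodSet σ f I α := by
  rintro _ ⟨q, ⟨hq, C, hC⟩, rfl⟩
  refine ⟨hfI _ hq, C + 1, ?_⟩
  rw [frequently_atTop] at hC ⊢
  intro N
  obtain ⟨n, hn, h⟩ := hC (N + 1)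
  obtain ⟨m, rfl⟩ : ∃ m, n = m + 1 := ⟨n - 1, by omega⟩
  refine ⟨m, by omega, ?_⟩
  have := bsum_shift σ f I m q
  push_cast at h ⊢
  linarith

theorem limsup_set {Ω : Type*} [MeasurableSpace Ω] (ℙ : Measure Ω) [IsProbabilityMeasure ℙ]
    (E : ℕ → Set Ω) (h : liminf (fun n => ℙ (E n)) atTop < 1) :
    ℙ {ω | ∃ᶠ n in atTop, ω ∉ E n} ≠ 0 := by
  intro h0
  refine absurd h (not_lt.2 ?_)
  have hmono : Monotone fun N : ℕ => {ω | ∀ n, N ≤ n → ω ∈ E n} :=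
    fun a b hab ω hω n hn => hω n (hab.trans hn)
  have ht := tendsto_measure_iUnion_atTop (μ := ℙ) hmono
  have h1 : ℙ (⋃ N : ℕ, {ω | ∀ n, N ≤ n → ω ∈ E n}) = 1 := by
    rw [← measure_univ (μ := ℙ)]
    apply measure_congr
    rw [eventuallyEq_univ]
    have : ∀ᵐ ω ∂ℙ, ¬ ∃ᶠ n in atTop, ω ∉ E n := by
      rw [ae_iff]; simpa only [not_not] using h0
    filter_upwards [this] with ω hω
    simpa [frequently_atTop] using hω
  rw [h1] at ht
  rw [← ht.liminf_eq]
  exact liminf_le_liminf (Eventually.of_forall fun N => measure_mono fun ω hω => hω N le_rfl)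

theorem half {Ω : Type*} [MeasurableSpace Ω]
    (ℙ : Measure Ω) [IsProbabilityMeasure ℙ] (σ : Ω → Ω) (hσ : Measurable σ)
    (f : Ω → ℝ → ℝ) (hfm : Measurable (Function.uncurry f))
    (hfI : ∀ ω, MapsTo (f ω) (Icc (0:ℝ) 1) (Icc (0:ℝ) 1))
    (herg : ErgodicRef ℙ σ f) (I : Set ℝ) (hI : MeasurableSet I)
    (B : Set ℝ) (hB : B ⊆ Icc (0:ℝ) 1) (hBpos : 0 < volume B)
    (hFL : ∀ α ∈ Ioo (0:ℝ) 1, ∀ x ∈ B,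
      Filter.liminf (fun n : ℕ => ℙ {ω : Ω | (n:ℝ)⁻¹ *
        ∑ j ∈ Finset.range n, I.indicator 1 (fib σ f ω j x) ≤ α})
        atTop < 1) :
    ∀ᵐ q ∂(refMeasure ℙ), Filter.limsup (fun n : ℕ => (n:ℝ)⁻¹ *
        ∑ j ∈ Finset.range n, I.indicator 1 (fib σ f q.1 j q.2)) atTop = 1 := by
  have hprob : IsProbabilityMeasure (volume.restrict (Icc (0:ℝ) 1)) := ⟨by simp⟩
  have hprob2 : IsProbabilityMeasure (refMeasure ℙ) := by unfold refMeasure; infer_instance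
  have key : ∀ α ∈ Ioo (0:ℝ) 1, ∀ᵐ q ∂(refMeasure ℙ), q ∈ goodSet σ f I α := by
    intro α hα
    have hm := goodSet_measurable hσ hfm hI α
    rcases herg _ hm (fun q hq => ⟨trivial, hq.1⟩) (goodSet_inv hfI hα.1) with h | h
    · exfalso
      rw [refMeasure, Measure.prod_apply_symm hm,
        lintegral_eq_zero_iff (measurable_measure_prodMk_right hm)] at h
      have h2 : ∀ᵐ x ∂(volume.restrict (Icc (0:ℝ) 1)), x ∉ B := by
        filter_upwards [h] with x hx hxB
        refine limsup_set ℙ _ (hFL α hα x hxB) (measure_mono_null ?_ hx)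
        intro ω hω
        refine ⟨hB hxB, 0, hω.mp ?_⟩
        filter_upwards [eventually_gt_atTop 0] with n hn hnE
        simp only [mem_setOf_eq, not_le] at hnE
        have hn' : (0:ℝ) < n := by exact_mod_cast hn
        rw [inv_mul_eq_div, lt_div_iff₀ hn'] at hnE
        simpa [bsum] using hnE
      rw [ae_iff] at h2
      simp only [not_not, setOf_mem_eq] at h2
      rw [Measure.restrict_eq_self _ hB] at h2
      exact hBpos.ne' h2
    · exact (prob_compl_eq_zero_iff hm).2 h
  have key2 : ∀ᵐ q ∂(refMeasure ℙ), ∀ k : ℕ, q ∈ goodSet σ f I (1 - 1 / ((k:ℝ) + 2)) := by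
    rw [ae_all_iff]
    intro k
    have hk : (0:ℝ) ≤ k := Nat.cast_nonneg k
    refine key _ ⟨?_, ?_⟩
    · rw [sub_pos, div_lt_one (by positivity)]; linarith
    · have : 0 < 1 / ((k:ℝ) + 2) := by positivity
      linarith
  filter_upwards [key2] with q hq
  change limsup (fun n : ℕ => (n:ℝ)⁻¹ * bsum σ f I n q) atTop = 1
  have hle : ∀ n : ℕ, (n:ℝ)⁻¹ * bsum σ f I n q ≤ 1 := fun n => by
    rw [inv_mul_eq_div]
    exact div_le_one_of_le₀ (bsum_le ..) (Nat.cast_nonneg n)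
  have h0 : ∀ n : ℕ, 0 ≤ (n:ℝ)⁻¹ * bsum σ f I n q := fun n =>
    mul_nonneg (by positivity) (bsum_nonneg ..)
  have hbd : IsBoundedUnder (· ≤ ·) atTop (fun n : ℕ => (n:ℝ)⁻¹ * bsum σ f I n q) :=
    isBoundedUnder_of ⟨1, hle⟩
  have hbd' : IsBoundedUnder (· ≥ ·) atTop (fun n : ℕ => (n:ℝ)⁻¹ * bsum σ f I n q) :=
    isBoundedUnder_of ⟨0, h0⟩
  apply le_antisymm
  · exact limsup_le_of_le hbd'.isCoboundedUnder_le (Eventually.of_forall hle)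
  · refine le_of_forall_lt_imp_le_of_dense fun β hβ => ?_
    obtain ⟨k, hk⟩ := exists_nat_one_div_lt (sub_pos.2 hβ)
    obtain ⟨-, C, hC⟩ := hq k
    have hlt : β < 1 - 1 / ((k:ℝ) + 2) := by
      have : 1 / ((k:ℝ) + 2) ≤ 1 / ((k:ℝ) + 1) := by gcongr; norm_num
      linarith
    set α := 1 - 1 / ((k:ℝ) + 2)
    refine le_limsup_of_frequently_le (hC.mp ?_) hbd
    obtain ⟨M, hM⟩ := exists_nat_gt (C / (α - β))
    filter_upwards [eventually_gt_atTop 0, eventually_ge_atTop M] with n hn hnM h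
    have hn' : (0:ℝ) < n := by exact_mod_cast hn
    rw [inv_mul_eq_div, le_div_iff₀ hn']
    have h3 : C / (α - β) < n := hM.trans_le (by exact_mod_cast hnM)
    rw [div_lt_iff₀ (sub_pos.2 hlt)] at h3
    nlinarith

theorem statement5 {Ω : Type*} [MeasurableSpace Ω] [StandardBorelSpace Ω]
    (ℙ : Measure Ω) [IsProbabilityMeasure ℙ] (σ : Ω → Ω) (hσ : Ergodic σ ℙ)
    (f : Ω → ℝ → ℝ) (hfm : Measurable (Function.uncurry f))
    (hfI : ∀ ω, MapsTo (f ω) (Icc (0:ℝ) 1) (Icc (0:ℝ) 1))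
    (herg : ErgodicRef ℙ σ f)
    (γ₀ γ₁ : ℝ) (hγ₀ : γ₀ ∈ Ioo (0:ℝ) 1) (hγ₁ : γ₁ ∈ Ioo (0:ℝ) 1)
    (B₀ B₁ : Set ℝ) (hB₀m : MeasurableSet B₀) (hB₁m : MeasurableSet B₁)
    (hB₀ : B₀ ⊆ Icc (0:ℝ) 1) (hB₁ : B₁ ⊆ Icc (0:ℝ) 1)
    (hB₀pos : 0 < volume B₀) (hB₁pos : 0 < volume B₁)
    (hFL0 : ∀ α ∈ Ioo (0:ℝ) 1, ∀ x ∈ B₀,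
      Filter.liminf (fun n : ℕ => ℙ {ω : Ω | (n:ℝ)⁻¹ *
        ∑ j ∈ Finset.range n, (Icc (0:ℝ) γ₀).indicator 1 (fib σ f ω j x) ≤ α})
        atTop < 1)
    (hFL1 : ∀ α ∈ Ioo (0:ℝ) 1, ∀ x ∈ B₁,
      Filter.liminf (fun n : ℕ => ℙ {ω : Ω | (n:ℝ)⁻¹ *
        ∑ j ∈ Finset.range n, (Icc γ₁ (1:ℝ)).indicator 1 (fib σ f ω j x) ≤ α})
        atTop < 1) :
    (∀ᵐ q ∂(refMeasure ℙ), Filter.limsup (fun n : ℕ => (n:ℝ)⁻¹ *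
        ∑ j ∈ Finset.range n, (Icc (0:ℝ) γ₀).indicator 1 (fib σ f q.1 j q.2)) atTop = 1) ∧
    (∀ᵐ q ∂(refMeasure ℙ), Filter.limsup (fun n : ℕ => (n:ℝ)⁻¹ *
        ∑ j ∈ Finset.range n, (Icc γ₁ (1:ℝ)).indicator 1 (fib σ f q.1 j q.2)) atTop = 1) := by
  exact ⟨half ℙ σ hσ.measurable f hfm hfI herg _ measurableSet_Icc B₀ hB₀ hB₀pos hFL0,
    half ℙ σ hσ.measurable f hfm hfI herg _ measurableSet_Icc B₁ hB₁ hB₁pos hFL1⟩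
end
end
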